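/- arXiv:0807.1131 — 3 statements merged into one kernel-verified Lean document; each statement's English description precedes it below -/
import Mathlib

section
/- Let ABC be a triangle with incenter I; let X, Y, Z be the feet of the internal bisectors of angles ∠A, ∠B, ∠C; let D, E, F be the points where the incircle touches BC, CA, AB; let M′, N′, P′ be the midpoints of the circumcircle arcs BC, CA, AB not containing A, B, C respectively; and let A′, B′, C′ be the tangency points of the circumcircle with the mixtilinear incircles in the angles ∠A, ∠B, ∠C. Then the quadruples of points (A′, M′, X, D), (B′, N′, Y, E), (C′, P′, Z, F) are each concyclic, and the quadruples (B′, C′, X, D), (C′, A′, Y, E), (A′, B′, Z, F) are each concyclic. Moreover, the radical centers U, V, W of the circle pairs (A′M′XD), (B′C′XD); (B′N′YE), (C′A′YE); (C′P′ZF), (A′B′ZF) with the circumcircle are collinear, and U, V, W lie on the circles (AXA′), (BYB′), (CZC′) respectively. -/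
open EuclideanGeometry RealInnerProductSpace Real

noncomputable section

/-- The Euclidean plane. -/
abbrev Pt := EuclideanSpace ℝ (Fin 2)

/-- The point with homogeneous barycentric coordinates `(x : y : z)` with respect to `A B C`. -/
def bary (A B C : Pt) (x y z : ℝ) : Pt := (x + y + z)⁻¹ • (x • A + y • B + z • C)

/-- The incenter of triangle `ABC`, with barycentric coordinates `(a : b : c)`. -/
def incenterPt (A B C : Pt) : Pt := bary A B C (dist B C) (dist C A) (dist A B)

/-- The centroid of triangle `ABC`. -/
def centroidPt (A B C : Pt) : Pt := bary A B C 1 1 1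

/-- The power of a point `p` with respect to a circle `s`. -/
def spow (s : Sphere Pt) (p : Pt) : ℝ := dist p s.center ^ 2 - s.radius ^ 2

/-- The radical axis of two circles: the locus of points of equal power. -/
def radAxis (s t : Sphere Pt) : Set Pt := {p | spow s p = spow t p}

/-- Three circles are coaxal if the radical axes of all pairs coincide. -/
def Coaxal (s t u : Sphere Pt) : Prop := radAxis s t = radAxis t u ∧ radAxis t u = radAxis s u

/-- The isogonal-conjugate image (with respect to triangle `ABC`) of a set `L`:
for `L` a line this is the circumconic that is the isogonal conjugate of `L`. -/
def isogSet (A B C : Pt) (L : Set Pt) : Set Pt :=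
  {S | ∃ p q r : ℝ, p ≠ 0 ∧ q ≠ 0 ∧ r ≠ 0 ∧ p + q + r ≠ 0 ∧
    dist B C ^ 2 / p + dist C A ^ 2 / q + dist A B ^ 2 / r ≠ 0 ∧
    bary A B C p q r ∈ L ∧
    S = bary A B C (dist B C ^ 2 / p) (dist C A ^ 2 / q) (dist A B ^ 2 / r)}

/-- Direction of the internal bisector of the angle at `A` in triangle `ABC`
(sum of the unit vectors toward the other two vertices). -/
def intBisDir (A B C : Pt) : Pt := (dist A B)⁻¹ • (B - A) + (dist A C)⁻¹ • (C - A)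

/-- A circle is tangent to a line: they touch at a point and the line does not
enter the interior of the circle. -/
def TangentLine (s : Sphere Pt) (L : AffineSubspace ℝ Pt) : Prop :=
  ∃ p, p ∈ L ∧ p ∈ s ∧ ∀ q ∈ L, s.radius ≤ dist s.center q

/-- Two circles are tangent at a point `p`: `p` lies on both and is collinear with the centers. -/
def TangentAt (s t : Sphere Pt) (p : Pt) : Prop :=
  p ∈ s ∧ p ∈ t ∧ Collinear ℝ ({s.center, t.center, p} : Set Pt)

/-- The tripolar (trilinear polar) of the point with barycentrics `(u : v : w)`,
as the set of points with barycentrics `(x:y:z)` satisfying `x/u + y/v + z/w = 0`. -/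
def tripolarSet (A B C : Pt) (u v w : ℝ) : Set Pt :=
  {S | ∃ x y z : ℝ, x + y + z ≠ 0 ∧ S = bary A B C x y z ∧ x / u + y / v + z / w = 0}

/-- `(P, Q; R, S) = -1`: the four collinear points form a harmonic range. -/
def Harmonic (P Q R S : Pt) : Prop := ∃ k : ℝ, P - R = k • (Q - R) ∧ P - S = -k • (Q - S)

theorem dist_sq_coord (P Q : Pt) : dist P Q ^ 2 = (P 0 - Q 0) ^ 2 + (P 1 - Q 1) ^ 2 := by
  rw [EuclideanSpace.dist_eq, Real.sq_sqrt (by positivity), Fin.sum_univ_two, Real.dist_eq,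
    Real.dist_eq, sq_abs, sq_abs]

theorem bary_apply (A B C : Pt) (x y z : ℝ) (i : Fin 2) :
    bary A B C x y z i = (x + y + z)⁻¹ * (x * A i + y * B i + z * C i) := by
  simp [bary, mul_add, add_assoc]

theorem bary_rotate (A B C : Pt) (x y z : ℝ) : bary A B C x y z = bary B C A y z x := by
  ext i
  simp only [bary_apply]
  ring

theorem bary_smul (A B C : Pt) {k : ℝ} (hk : k ≠ 0) (x y z : ℝ) :
    bary A B C (k * x) (k * y) (k * z) = bary A B C x y z := by
  ext i
  simp only [bary_apply, ← mul_add, mul_assoc, mul_inv]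
  field_simp

theorem incenterPt_rotate (A B C : Pt) : incenterPt A B C = incenterPt B C A :=
  bary_rotate ..

theorem spow_bary (s : Sphere Pt) (A B C : Pt) {x y z : ℝ} (h : x + y + z ≠ 0) :
    (x + y + z) ^ 2 * spow s (bary A B C x y z) =
      (x + y + z) * (x * spow s A + y * spow s B + z * spow s C) -
        (dist B C ^ 2 * y * z + dist C A ^ 2 * z * x + dist A B ^ 2 * x * y) := by
  simp only [spow, dist_sq_coord, bary_apply]
  field_simp
  ring

theorem spow_eq_zero_of_mem {s : Sphere Pt} {P : Pt} (h : P ∈ s) : spow s P = 0 := by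
  rw [spow, mem_sphere.1 h, sub_self]

theorem mem_of_spow_eq_zero {s : Sphere Pt} {P Q : Pt} (hQ : Q ∈ s) (h : spow s P = 0) :
    P ∈ s := by
  have hr : 0 ≤ s.radius := mem_sphere.1 hQ ▸ dist_nonneg
  exact mem_sphere.2 ((sq_eq_sq₀ dist_nonneg hr).1 (sub_eq_zero.1 h))

theorem lineMap_apply_coord (P Q : Pt) (t : ℝ) (i : Fin 2) :
    AffineMap.lineMap P Q t i = (1 - t) * P i + t * Q i := by
  simp [AffineMap.lineMap_apply]
  ring

theorem exists_lineMap_eq {P Q R : Pt} (h : R ∈ line[ℝ, P, Q]) :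
    ∃ t : ℝ, AffineMap.lineMap P Q t = R := by
  rw [← vsub_vadd R P, vadd_left_mem_affineSpan_pair] at h
  obtain ⟨t, ht⟩ := h
  exact ⟨t, by rw [AffineMap.lineMap_apply, ht, vsub_vadd]⟩

theorem two_mul_inner_sub_sub (P Q R S : Pt) :
    2 * ⟪P - Q, R - S⟫ = dist P S ^ 2 - dist P R ^ 2 - dist Q S ^ 2 + dist Q R ^ 2 := by
  simp only [dist_sq_coord, PiLp.inner_apply, Fin.sum_univ_two, PiLp.sub_apply,
    RCLike.inner_apply, conj_trivial]
  ring

theorem spow_lineMap (s : Sphere Pt) (P Q : Pt) (t : ℝ) :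
    spow s (AffineMap.lineMap P Q t) =
      (1 - t) * spow s P + t * spow s Q - dist P Q ^ 2 * t * (1 - t) := by
  simp only [spow, dist_sq_coord, lineMap_apply_coord]
  ring

theorem concyclic_of_mem {s : Sphere Pt} {P Q R S : Pt} (hP : P ∈ s) (hQ : Q ∈ s) (hR : R ∈ s)
    (hS : S ∈ s) : Concyclic ({P, Q, R, S} : Set Pt) := by
  refine ⟨⟨s.center, s.radius, ?_⟩, coplanar_of_finrank_eq_two _ (by simp)⟩
  rintro T (rfl | rfl | rfl | rfl) <;> exact mem_sphere.1 ‹_›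

/-- A circle tangent to the line `PQ` touches it at a point where its power has a double zero. -/
theorem TangentLine.exists_touch {s : Sphere Pt} {P Q : Pt} (hPQ : P ≠ Q)
    (h : TangentLine s line[ℝ, P, Q]) :
    ∃ t : ℝ, AffineMap.lineMap P Q t ∈ s ∧ spow s P = dist P Q ^ 2 * t ^ 2 ∧
      spow s Q = dist P Q ^ 2 * (1 - t) ^ 2 := by
  obtain ⟨p, hp, hps, hle⟩ := h
  obtain ⟨t, rfl⟩ := exists_lineMap_eq hp
  have hr : 0 ≤ s.radius := mem_sphere.1 hps ▸ dist_nonneg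
  have hd : 0 < dist P Q ^ 2 := pow_pos (dist_pos.2 hPQ) 2
  have h0 := spow_eq_zero_of_mem hps
  have hnonneg (τ : ℝ) : 0 ≤ spow s (AffineMap.lineMap P Q τ) := by
    have := hle _ (AffineMap.lineMap_mem_affineSpan_pair τ P Q)
    rw [dist_comm] at this
    exact sub_nonneg.2 (pow_le_pow_left₀ hr this 2)
  simp only [spow_lineMap] at h0 hnonneg
  generalize dist P Q ^ 2 = d at *
  set e := 2 * d * t + spow s Q - spow s P - d with he
  have he0 : e = 0 := by
    have h1 := hnonneg (t - e / (2 * d))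
    have h2 : (1 - (t - e / (2 * d))) * spow s P + (t - e / (2 * d)) * spow s Q -
        d * (t - e / (2 * d)) * (1 - (t - e / (2 * d))) = -(e ^ 2 / (4 * d)) := by
      have h3 : e / (2 * d) * d = e / 2 := by field_simp
      have h4 : e ^ 2 / (4 * d) = e / (2 * d) * (e / 2) := by field_simp; norm_num
      rw [h4]
      generalize e / (2 * d) = f at *
      linear_combination h0 + f * h3 + f * he
    rw [h2] at h1
    have h3 : 0 ≤ e ^ 2 / (4 * d) := by positivity
    have h4 : e ^ 2 / (4 * d) = 0 := by linarith
    simpa [hd.ne'] using h4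
  rw [he0] at he
  refine ⟨t, hps, ?_, ?_⟩
  · linear_combination h0 + t * he
  · linear_combination h0 - (1 - t) * he

/-- Casey-type power formula: for `s` internally tangent to `O` at `T`, the power with respect to
`s` of points of `O` is proportional to the squared distance to `T`. -/
theorem exists_spow_eq_of_internally_tangent {O s : Sphere Pt} {T : Pt}
    (h : dist O.center s.center = O.radius - s.radius) (hTs : T ∈ s) (hTO : T ∈ O) :
    ∃ k : ℝ, 0 ≤ k ∧ ∀ P ∈ O, spow s P = k * dist T P ^ 2 := by
  have hw : Wbtw ℝ O.center s.center T := by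
    rw [← dist_add_dist_eq_iff, h, dist_comm, mem_sphere.1 hTs, dist_comm, mem_sphere.1 hTO]
    ring
  obtain ⟨k, hk, hks⟩ := hw
  refine ⟨k, hk.1, fun P hP => ?_⟩
  have h1 : dist P O.center ^ 2 = dist T O.center ^ 2 := by
    rw [mem_sphere.1 hP, mem_sphere.1 hTO]
  rw [spow, ← mem_sphere.1 hTs, ← hks]
  simp only [dist_sq_coord, lineMap_apply_coord] at h1 ⊢
  linear_combination (1 - k) * h1

/-- A nondegenerate triangle `ABC` whose tangent lengths to the incircle are `x`, `y`, `z`. -/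
structure IsRavi (A B C : Pt) (x y z : ℝ) : Prop where
  not_collinear : ¬ Collinear ℝ ({A, B, C} : Set Pt)
  pos_x : 0 < x
  pos_y : 0 < y
  pos_z : 0 < z
  dist_BC : dist B C = y + z
  dist_CA : dist C A = z + x
  dist_AB : dist A B = x + y

theorem dist_lt_of_not_collinear {A B C : Pt} (h : ¬ Collinear ℝ ({A, B, C} : Set Pt)) :
    dist A C < dist A B + dist B C :=
  dist_lt_dist_add_dist_iff.2 fun hw => h hw.collinear

namespace IsRavi

variable {A B C : Pt} {x y z : ℝ}

theorem rotate (h : IsRavi A B C x y z) : IsRavi B C A y z x where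
  not_collinear := by
    rw [Set.pair_comm C A, Set.insert_comm]
    exact h.not_collinear
  pos_x := h.pos_y
  pos_y := h.pos_z
  pos_z := h.pos_x
  dist_BC := h.dist_CA
  dist_CA := h.dist_AB
  dist_AB := h.dist_BC

theorem of_not_collinear (h : ¬ Collinear ℝ ({A, B, C} : Set Pt)) :
    IsRavi A B C ((dist C A + dist A B - dist B C) / 2) ((dist A B + dist B C - dist C A) / 2)
      ((dist B C + dist C A - dist A B) / 2) where
  not_collinear := h
  pos_x := by
    have := dist_lt_of_not_collinear (A := B) (B := A) (C := C) (by rwa [Set.insert_comm])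
    rw [dist_comm B A, dist_comm A C] at this
    linarith
  pos_y := by
    have := dist_lt_of_not_collinear h
    rw [dist_comm A C] at this
    linarith
  pos_z := by
    have := dist_lt_of_not_collinear (A := A) (B := C) (C := B) (by rwa [Set.pair_comm])
    rw [dist_comm A C, dist_comm C B] at this
    linarith
  dist_BC := by ring
  dist_CA := by ring
  dist_AB := by ring

theorem ne_AB (h : IsRavi A B C x y z) : A ≠ B := by
  rw [← dist_pos, h.dist_AB]
  linarith [h.pos_x, h.pos_y]

theorem ne_AC (h : IsRavi A B C x y z) : A ≠ C := by
  rw [← dist_pos, dist_comm, h.dist_CA]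
  linarith [h.pos_x, h.pos_z]

theorem exists_bary (h : IsRavi A B C x y z) (P : Pt) :
    ∃ α β γ : ℝ, α + β + γ = 1 ∧ P = bary A B C α β γ := by
  have hi : AffineIndependent ℝ ![A, B, C] :=
    affineIndependent_iff_not_collinear_set.2 h.not_collinear
  have htop : affineSpan ℝ (Set.range ![A, B, C]) = ⊤ :=
    (hi.affineSpan_eq_top_iff_card_eq_finrank_add_one).2 (by simp)
  obtain ⟨w, hw, hP⟩ := eq_affineCombination_of_mem_affineSpan_of_fintype
    (k := ℝ) (p := ![A, B, C]) (p1 := P) (by rw [htop]; trivial)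
  refine ⟨w 0, w 1, w 2, by rw [← hw, Fin.sum_univ_three], ?_⟩
  rw [hP, Finset.affineCombination_eq_linear_combination _ _ _ hw, bary]
  rw [Fin.sum_univ_three] at hw ⊢
  simp [hw]

theorem spow_bary_eq (h : IsRavi A B C x y z) (s : Sphere Pt) {p q r : ℝ} (hs : p + q + r ≠ 0) :
    (p + q + r) ^ 2 * spow s (bary A B C p q r) =
      (p + q + r) * (p * spow s A + q * spow s B + r * spow s C) -
        ((y + z) ^ 2 * q * r + (z + x) ^ 2 * r * p + (x + y) ^ 2 * p * q) := by
  rw [spow_bary s A B C hs, h.dist_AB, h.dist_BC, h.dist_CA]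

theorem eq_of_bary_mem (h : IsRavi A B C x y z) {s : Sphere Pt} {p q r : ℝ}
    (hs : p + q + r ≠ 0) (hm : bary A B C p q r ∈ s) :
    (p + q + r) * (p * spow s A + q * spow s B + r * spow s C) =
        (y + z) ^ 2 * q * r + (z + x) ^ 2 * r * p + (x + y) ^ 2 * p * q := by
  have := h.spow_bary_eq s hs
  rw [spow_eq_zero_of_mem hm] at this
  linarith

/-- The point where the `A`-mixtilinear incircle touches the circumcircle. -/
theorem mixtilinear_touch (h : IsRavi A B C x y z) {O K : Sphere Pt} {A' : Pt}
    (hAO : A ∈ O) (hBO : B ∈ O) (hCO : C ∈ O)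
    (hK₁ : TangentLine K line[ℝ, A, B]) (hK₂ : TangentLine K line[ℝ, A, C])
    (hK₃ : dist O.center K.center = O.radius - K.radius) (hK₄ : A' ∈ K) (hK₅ : A' ∈ O) :
    A' = A ∨ A' = bary A B C (-(y + z) * y * z) ((z + x) ^ 2 * z) ((x + y) ^ 2 * y) := by
  have hx := h.pos_x
  have hy := h.pos_y
  have hz := h.pos_z
  have in_disk {P : Pt} (hP : P ∈ K) : spow O P ≤ 0 := by
    have h1 := dist_triangle P K.center O.center
    rw [mem_sphere.1 hP, dist_comm K.center, hK₃, add_sub_cancel] at h1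
    exact sub_nonpos.2 (pow_le_pow_left₀ dist_nonneg h1 2)
  have le_one {d t : ℝ} (hd : 0 < d) (ht : -(d * t * (1 - t)) ≤ 0) : 0 ≤ t ∧ t ≤ 1 := by
    have : 0 ≤ t * (1 - t) := by
      by_contra! hneg
      nlinarith
    constructor <;> nlinarith
  obtain ⟨β, hβK, hA₁, hB⟩ := hK₁.exists_touch h.ne_AB
  obtain ⟨γ, hγK, hA₂, hC⟩ := hK₂.exists_touch h.ne_AC
  have hβ := in_disk hβK
  have hγ := in_disk hγK
  rw [spow_lineMap, spow_eq_zero_of_mem hAO] at hβ hγ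
  rw [spow_eq_zero_of_mem hBO] at hβ
  rw [spow_eq_zero_of_mem hCO] at hγ
  simp only [dist_comm A C, h.dist_AB, h.dist_CA, mul_zero, zero_add, zero_sub]
    at hβ hγ hA₁ hA₂ hB hC
  obtain ⟨hβ0, hβ1⟩ := le_one (by positivity) hβ
  obtain ⟨hγ0, hγ1⟩ := le_one (by positivity) hγ
  obtain ⟨t, ht⟩ : ∃ t, t = (x + y) * β := ⟨_, rfl⟩
  have ht' : t = (z + x) * γ := by
    refine (sq_eq_sq₀ (by rw [ht]; positivity) (by positivity)).1 ?_
    rw [ht]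
    linear_combination hA₂ - hA₁
  have ht0 : 0 ≤ t := by rw [ht]; positivity
  have htc : t ≤ x + y := by rw [ht]; nlinarith
  have htb : t ≤ z + x := by rw [ht']; nlinarith
  replace hA₁ : spow K A = t ^ 2 := by rw [hA₁, ht]; ring
  replace hB : spow K B = (x + y - t) ^ 2 := by rw [hB, ht]; ring
  replace hC : spow K C = (z + x - t) ^ 2 := by rw [hC, ht']; ring
  clear ht ht' hA₂ hβ hγ hβ0 hβ1 hγ0 hγ1 hβK hγK
  obtain ⟨k, hk, hkO⟩ := exists_spow_eq_of_internally_tangent hK₃ hK₄ hK₅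
  obtain ⟨α, β, γ, hsum, rfl⟩ := h.exists_bary A'
  have hcirc := h.eq_of_bary_mem (by rw [hsum]; exact one_ne_zero) hK₅
  simp only [spow_eq_zero_of_mem hAO, spow_eq_zero_of_mem hBO, spow_eq_zero_of_mem hCO, hsum,
    mul_zero, add_zero] at hcirc
  have hdist (P : Pt) : dist (bary A B C α β γ) P ^ 2 =
      α * dist A P ^ 2 + β * dist B P ^ 2 + γ * dist C P ^ 2 := by
    have := h.spow_bary_eq ⟨P, 0⟩ (p := α) (q := β) (r := γ) (by rw [hsum]; exact one_ne_zero)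
    simp only [hsum, ← hcirc, spow] at this
    linear_combination this
  have eA := hkO A hAO
  have eB := hkO B hBO
  have eC := hkO C hCO
  rw [hdist] at eA eB eC
  rw [hA₁] at eA
  rw [hB] at eB
  rw [hC] at eC
  simp only [dist_self, dist_comm A C, dist_comm B A, dist_comm C B, h.dist_AB, h.dist_BC,
    h.dist_CA] at eA eB eC
  have hk0 : k ≠ 0 := by
    rintro rfl
    have h1 : t = 0 := by simpa using eA
    have h2 : x + y - t = 0 := by simpa using eB
    linarith
  have fα : 2 * (z + x) ^ 2 * (x + y) ^ 2 * (k * α) = (z + x) ^ 2 * (x + y - t) ^ 2 +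
      (x + y) ^ 2 * (z + x - t) ^ 2 - (y + z) ^ 2 * t ^ 2 := by
    rw [eA, eB, eC]; ring
  have fβ : 2 * (y + z) ^ 2 * (x + y) ^ 2 * (k * β) = (y + z) ^ 2 * t ^ 2 +
      (x + y) ^ 2 * (z + x - t) ^ 2 - (z + x) ^ 2 * (x + y - t) ^ 2 := by
    rw [eA, eB, eC]; ring
  have fγ : 2 * (y + z) ^ 2 * (z + x) ^ 2 * (k * γ) = (y + z) ^ 2 * t ^ 2 +
      (z + x) ^ 2 * (x + y - t) ^ 2 - (x + y) ^ 2 * (z + x - t) ^ 2 := by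
    rw [eA, eB, eC]; ring
  have hsingle : α * t ^ 2 + β * (x + y - t) ^ 2 + γ * (z + x - t) ^ 2 = 0 := by
    rw [eA, eB, eC]
    linear_combination (-2 * k) * hcirc
  have hquartic : ((y + z) * t + (z + x) * (x + y - t) + (x + y) * (z + x - t)) *
      (-(y + z) * t + (z + x) * (x + y - t) + (x + y) * (z + x - t)) *
      ((y + z) * t - (z + x) * (x + y - t) + (x + y) * (z + x - t)) *
      ((y + z) * t + (z + x) * (x + y - t) - (x + y) * (z + x - t)) = 0 := by
    linear_combination 2 * (y + z) ^ 2 * (z + x) ^ 2 * (x + y) ^ 2 * k * hsingle -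
      (y + z) ^ 2 * t ^ 2 * fα - (z + x) ^ 2 * (x + y - t) ^ 2 * fβ -
      (x + y) ^ 2 * (z + x - t) ^ 2 * fγ
  have hfac : t * t * ((x + y + z) * t - (x + y) * (z + x)) = 0 := by
    have hpos : 0 < (y + z) * t + (z + x) * (x + y - t) + (x + y) * (z + x - t) := by
      rcases ht0.eq_or_lt with rfl | ht0
      · simp only [mul_zero, sub_zero, zero_add]; positivity
      · have : 0 ≤ x + y - t := by linarith
        have : 0 ≤ z + x - t := by linarith
        positivity
    have h1 : (((y + z) * t + (z + x) * (x + y - t) + (x + y) * (z + x - t)) * (8 * y * z)) *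
        (t * t * ((x + y + z) * t - (x + y) * (z + x))) = 0 := by
      linear_combination (-1) * hquartic
    exact (mul_eq_zero.1 h1).resolve_left (by positivity)
  rcases mul_eq_zero.1 hfac with ht | ht
  · left
    have ht : t = 0 := by simpa using ht
    subst ht
    have hβ : β = 0 := by
      have : ((y + z) ^ 2 * (x + y) ^ 2 * k) * β = 0 := by linear_combination fβ / 2
      exact (mul_eq_zero.1 this).resolve_left (by positivity)
    have hγ : γ = 0 := by
      have : ((y + z) ^ 2 * (z + x) ^ 2 * k) * γ = 0 := by linear_combination fγ / 2
      exact (mul_eq_zero.1 this).resolve_left (by positivity)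
    have hα : α = 1 := by linarith
    ext i
    simp [bary_apply, hα, hβ, hγ]
  · right
    have ht₁ : (x + y + z) ^ 2 * t ^ 2 = (x + y) ^ 2 * (z + x) ^ 2 := by
      linear_combination ((x + y + z) * t + (x + y) * (z + x)) * ht
    have ht₂ : (x + y + z) ^ 2 * (x + y - t) ^ 2 = (x + y) ^ 2 * y ^ 2 := by
      linear_combination (-((x + y + z) * (x + y - t)) - (x + y) * y) * ht
    have ht₃ : (x + y + z) ^ 2 * (z + x - t) ^ 2 = (z + x) ^ 2 * z ^ 2 := by
      linear_combination (-((x + y + z) * (z + x - t)) - (z + x) * z) * ht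
    have gα : α * ((x + y + z) ^ 2 * k * (y + z)) = -(y + z) * y * z := by
      apply mul_left_cancel₀ (show 2 * (z + x) ^ 2 * (x + y) ^ 2 ≠ 0 by positivity)
      linear_combination (y + z) * ((x + y + z) ^ 2 * fα + (z + x) ^ 2 * ht₂ +
        (x + y) ^ 2 * ht₃ - (y + z) ^ 2 * ht₁)
    have gβ : β * ((x + y + z) ^ 2 * k * (y + z)) = (z + x) ^ 2 * z := by
      apply mul_left_cancel₀ (show 2 * (y + z) * (x + y) ^ 2 ≠ 0 by positivity)
      linear_combination (x + y + z) ^ 2 * fβ + (y + z) ^ 2 * ht₁ + (x + y) ^ 2 * ht₃ -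
        (z + x) ^ 2 * ht₂
    have gγ : γ * ((x + y + z) ^ 2 * k * (y + z)) = (x + y) ^ 2 * y := by
      apply mul_left_cancel₀ (show 2 * (y + z) * (z + x) ^ 2 ≠ 0 by positivity)
      linear_combination (x + y + z) ^ 2 * fγ + (y + z) ^ 2 * ht₁ + (z + x) ^ 2 * ht₂ -
        (x + y) ^ 2 * ht₃
    rw [← gα, ← gβ, ← gγ, mul_comm α, mul_comm β, mul_comm γ, bary_smul]
    positivity

theorem eq_bary_arc_midpoint (h : IsRavi A B C x y z) {O : Sphere Pt} {M : Pt}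
    (hAO : A ∈ O) (hBO : B ∈ O) (hCO : C ∈ O) (hMO : M ∈ O)
    (hM : M ∈ line[ℝ, A, incenterPt A B C]) (hMA : M ≠ A) :
    M = bary A B C (-(y + z) ^ 2) ((z + x) * (2 * x + y + z)) ((x + y) * (2 * x + y + z)) := by
  have hx := h.pos_x
  have hy := h.pos_y
  have hz := h.pos_z
  obtain ⟨t, rfl⟩ := exists_lineMap_eq hM
  have hbary : AffineMap.lineMap A (incenterPt A B C) t =
      bary A B C (2 * (x + y + z) - t * (2 * x + y + z)) (t * (z + x)) (t * (x + y)) := by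
    ext i
    simp only [lineMap_apply_coord, incenterPt, bary_apply, h.dist_AB, h.dist_BC, h.dist_CA]
    have h1 : y + z + (z + x) + (x + y) ≠ 0 := by positivity
    have h2 : 2 * (x + y + z) - t * (2 * x + y + z) + t * (z + x) + t * (x + y) =
      y + z + (z + x) + (x + y) := by ring
    rw [h2]
    field_simp
    ring
  rw [hbary] at hMO
  have := h.eq_of_bary_mem (by ring_nf; positivity) hMO
  simp only [spow_eq_zero_of_mem hAO, spow_eq_zero_of_mem hBO, spow_eq_zero_of_mem hCO] at this
  have ht0 : t ≠ 0 := by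
    rintro rfl
    simp at hMA
  have ht : 2 * x * t = 2 * x + y + z := by
    have h1 : (2 * t * (z + x) * (x + y) * (x + y + z)) * (2 * x * t - (2 * x + y + z)) = 0 := by
      linear_combination this
    refine sub_eq_zero.1 ((mul_eq_zero.1 h1).resolve_left ?_)
    have : 0 < (z + x) * (x + y) * (x + y + z) := by positivity
    contrapose! ht0
    nlinarith
  rw [hbary, ← bary_smul A B C (show 2 * x ≠ 0 by positivity)]
  congr 1
  · linear_combination (-(2 * x + y + z)) * ht
  · linear_combination (z + x) * ht
  · linear_combination (x + y) * ht

theorem eq_bary_incircle_touch (h : IsRavi A B C x y z) {D : Pt} (hD : D ∈ line[ℝ, B, C])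
    (hDI : ⟪D - incenterPt A B C, C - B⟫ = 0) : D = bary A B C 0 z y := by
  have hx := h.pos_x
  have hy := h.pos_y
  have hz := h.pos_z
  obtain ⟨t, rfl⟩ := exists_lineMap_eq hD
  have ht : (y + z) * t = y := by
    have h1 := two_mul_inner_sub_sub (AffineMap.lineMap B C t) (incenterPt A B C) C B
    have h2 := spow_lineMap ⟨B, 0⟩ B C t
    have h3 := spow_lineMap ⟨C, 0⟩ B C t
    have hs : (y + z) + (z + x) + (x + y) ≠ 0 := by positivity
    have h4 := h.spow_bary_eq ⟨B, 0⟩ hs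
    have h5 := h.spow_bary_eq ⟨C, 0⟩ hs
    have h6 : incenterPt A B C = bary A B C (y + z) (z + x) (x + y) := by
      rw [incenterPt, h.dist_AB, h.dist_BC, h.dist_CA]
    rw [hDI, h6] at h1
    simp only [spow, dist_self, dist_comm C B, dist_comm A C, h.dist_AB, h.dist_BC, h.dist_CA]
      at h2 h3 h4 h5
    have h7 : 0 < 8 * (x + y + z) ^ 2 * (y + z) := by positivity
    apply mul_left_cancel₀ h7.ne'
    linear_combination (-4) * (x + y + z) ^ 2 * (h1 + h2 - h3) + h4 - h5
  ext i
  rw [lineMap_apply_coord, bary_apply]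
  field_simp
  linear_combination (C i - B i) * ht

theorem spow_rel_of_touch_mem (h : IsRavi A B C x y z) {s : Sphere Pt}
    (hs : bary A B C (-(y + z) * y * z) ((z + x) ^ 2 * z) ((x + y) ^ 2 * y) ∈ s) :
    (z + x) ^ 2 * z * spow s B + (x + y) ^ 2 * y * spow s C = (y + z) * y * z * spow s A := by
  have hx := h.pos_x
  have hy := h.pos_y
  have hz := h.pos_z
  have hsum : 0 < -(y + z) * y * z + (z + x) ^ 2 * z + (x + y) ^ 2 * y := by
    have : 0 < x ^ 2 * z + 2 * x * z ^ 2 + x ^ 2 * y + 2 * x * y ^ 2 := by positivity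
    have : 0 ≤ (y + z) * (y - z) ^ 2 := by positivity
    linarith
  have := h.eq_of_bary_mem hsum.ne' hs
  refine sub_eq_zero.1 ((mul_eq_zero.1 ?_).resolve_left hsum.ne')
  linear_combination this

theorem spow_rel_of_arc_midpoint_mem (h : IsRavi A B C x y z) {s : Sphere Pt}
    (hs : bary A B C (-(y + z) ^ 2) ((z + x) * (2 * x + y + z)) ((x + y) * (2 * x + y + z)) ∈ s) :
    (2 * x + y + z) * ((z + x) * spow s B + (x + y) * spow s C) = (y + z) ^ 2 * spow s A := by
  have hx := h.pos_x
  have hy := h.pos_y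
  have hz := h.pos_z
  have hsum : 0 < -(y + z) ^ 2 + (z + x) * (2 * x + y + z) + (x + y) * (2 * x + y + z) := by
    ring_nf
    positivity
  have := h.eq_of_bary_mem hsum.ne' hs
  refine sub_eq_zero.1 ((mul_eq_zero.1 ?_).resolve_left hsum.ne')
  linear_combination this

theorem spow_rel_of_bisector_foot_mem (h : IsRavi A B C x y z) {s : Sphere Pt}
    (hs : bary A B C 0 (z + x) (x + y) ∈ s) :
    (2 * x + y + z) * ((z + x) * spow s B + (x + y) * spow s C) =
      (y + z) ^ 2 * (z + x) * (x + y) := by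
  have hx := h.pos_x
  have hy := h.pos_y
  have hz := h.pos_z
  linear_combination h.eq_of_bary_mem (by positivity) hs

theorem mixtilinear_touch_ne (h : IsRavi A B C x y z) {s : Sphere Pt} {A' : Pt} (hA' : A' ∈ s)
    (hM : bary A B C (-(y + z) ^ 2) ((z + x) * (2 * x + y + z)) ((x + y) * (2 * x + y + z)) ∈ s)
    (hX : bary A B C 0 (z + x) (x + y) ∈ s) : A' ≠ A := by
  rintro rfl
  have hx := h.pos_x
  have hy := h.pos_y
  have hz := h.pos_z
  have h1 := h.spow_rel_of_arc_midpoint_mem hM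
  rw [h.spow_rel_of_bisector_foot_mem hX, spow_eq_zero_of_mem hA', mul_zero] at h1
  have : 0 < (y + z) ^ 2 * (z + x) * (x + y) := by positivity
  exact this.ne' h1

/-- A circle through the foot of the bisector of `A` for which the powers of `B` and `C` are in
the ratio `AB · BD : AC · CD` passes through the incircle touch point `D` on `BC`. -/
theorem spow_of_ratio (h : IsRavi A B C x y z) {s : Sphere Pt}
    (hX : bary A B C 0 (z + x) (x + y) ∈ s)
    (hr : (z + x) * z * spow s B = (x + y) * y * spow s C) :
    (2 * x + y + z) * spow s B = (y + z) * (x + y) * y ∧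
      (2 * x + y + z) * spow s C = (y + z) * (z + x) * z ∧ bary A B C 0 z y ∈ s := by
  have hx := h.pos_x
  have hy := h.pos_y
  have hz := h.pos_z
  have h1 := h.spow_rel_of_bisector_foot_mem hX
  have hB : (2 * x + y + z) * spow s B = (y + z) * (x + y) * y := by
    apply mul_left_cancel₀ (show (z + x) * (y + z) ≠ 0 by positivity)
    linear_combination y * h1 + (2 * x + y + z) * hr
  have hC : (2 * x + y + z) * spow s C = (y + z) * (z + x) * z := by
    apply mul_left_cancel₀ (show (x + y) * (y + z) ≠ 0 by positivity)
    linear_combination z * h1 - (2 * x + y + z) * hr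
  refine ⟨hB, hC, mem_of_spow_eq_zero hX ?_⟩
  have h2 := h.spow_bary_eq s (p := 0) (q := z) (r := y) (by positivity)
  have h3 : (2 * x + y + z) * (y + z) ^ 2 ≠ 0 := by positivity
  refine (mul_eq_zero.1 ?_).resolve_left h3
  linear_combination (2 * x + y + z) * h2 + (y + z) * z * hB + (y + z) * y * hC

theorem ne_of_touch_mem (h : IsRavi A B C x y z) {s : Sphere Pt} (hA : A ∈ s)
    (hX : bary A B C 0 (z + x) (x + y) ∈ s)
    (hA' : bary A B C (-(y + z) * y * z) ((z + x) ^ 2 * z) ((x + y) ^ 2 * y) ∈ s) : y ≠ z := by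
  rintro rfl
  have hx := h.pos_x
  have hy := h.pos_y
  have h1 := h.spow_rel_of_touch_mem hA'
  have h2 := h.spow_rel_of_bisector_foot_mem hX
  rw [spow_eq_zero_of_mem hA] at h1
  have : 0 < (y + y) ^ 2 * (y + x) * (x + y) * (y * (x + y)) := by positivity
  apply this.ne'
  linear_combination (2 * x + y + y) * h1 - (y * (x + y)) * h2

theorem spow_ratio_of_touch_arc_midpoint (h : IsRavi A B C x y z) (hyz : y ≠ z) {s : Sphere Pt}
    (hA' : bary A B C (-(y + z) * y * z) ((z + x) ^ 2 * z) ((x + y) ^ 2 * y) ∈ s)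
    (hM : bary A B C (-(y + z) ^ 2) ((z + x) * (2 * x + y + z)) ((x + y) * (2 * x + y + z)) ∈ s) :
    (z + x) * z * spow s B = (x + y) * y * spow s C := by
  have hx := h.pos_x
  have hy := h.pos_y
  have hz := h.pos_z
  have h1 := h.spow_rel_of_touch_mem hA'
  have h2 := h.spow_rel_of_arc_midpoint_mem hM
  apply mul_left_cancel₀ (mul_ne_zero (sub_ne_zero.2 hyz) (show x + y + z ≠ 0 by positivity))
  linear_combination y * z * h2 - (y + z) * h1

theorem spow_ratio_of_touch_touch (h : IsRavi A B C x y z) {s : Sphere Pt}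
    (hB' : bary B C A (-(z + x) * z * x) ((x + y) ^ 2 * x) ((y + z) ^ 2 * z) ∈ s)
    (hC' : bary C A B (-(x + y) * x * y) ((y + z) ^ 2 * y) ((z + x) ^ 2 * x) ∈ s) :
    (z + x) * z * spow s B = (x + y) * y * spow s C := by
  have hx := h.pos_x
  have hy := h.pos_y
  have hz := h.pos_z
  have h1 := h.rotate.spow_rel_of_touch_mem hB'
  have h2 := h.rotate.rotate.spow_rel_of_touch_mem hC'
  apply mul_left_cancel₀ (show x * (x + y + z) ≠ 0 by positivity)
  linear_combination z * h2 - y * h1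

/-- The radical center is the point where `BC` meets the tripolar of
`(a / (s - a) : b / (s - b) : c / (s - c))`. -/
theorem eq_bary_radical_center (h : IsRavi A B C x y z) (hyz : y ≠ z)
    {O c₁ c₂ : Sphere Pt} {U : Pt}
    (hAO : A ∈ O) (hBO : B ∈ O) (hCO : C ∈ O)
    (hA' : bary A B C (-(y + z) * y * z) ((z + x) ^ 2 * z) ((x + y) ^ 2 * y) ∈ c₁)
    (hM : bary A B C (-(y + z) ^ 2) ((z + x) * (2 * x + y + z)) ((x + y) * (2 * x + y + z)) ∈ c₁)
    (hX₁ : bary A B C 0 (z + x) (x + y) ∈ c₁)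
    (hB' : bary B C A (-(z + x) * z * x) ((x + y) ^ 2 * x) ((y + z) ^ 2 * z) ∈ c₂)
    (hC' : bary C A B (-(x + y) * x * y) ((y + z) ^ 2 * y) ((z + x) ^ 2 * x) ∈ c₂)
    (hX₂ : bary A B C 0 (z + x) (x + y) ∈ c₂)
    (hU : spow c₁ U = spow c₂ U ∧ spow c₁ U = spow O U) :
    U = bary A B C 0 ((z + x) * z) (-((x + y) * y)) := by
  have hx := h.pos_x
  have hy := h.pos_y
  have hz := h.pos_z
  obtain ⟨hB₁, hC₁, -⟩ := h.spow_of_ratio hX₁ (h.spow_ratio_of_touch_arc_midpoint hyz hA' hM)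
  obtain ⟨hB₂, hC₂, -⟩ := h.spow_of_ratio hX₂ (h.spow_ratio_of_touch_touch hB' hC')
  have hA₁ : spow c₁ A = (z + x) * (x + y) := by
    apply mul_left_cancel₀ (show (y + z) ^ 2 ≠ 0 by positivity)
    linear_combination h.spow_rel_of_bisector_foot_mem hX₁ - h.spow_rel_of_arc_midpoint_mem hM
  have hA₂ : (y + z) * (2 * x + y + z) * spow c₂ A = -((z + x) * (x + y) * x ^ 2) := by
    apply mul_left_cancel₀ (show (y + z) * z ≠ 0 by positivity)
    linear_combination (2 * x + y + z) * h.rotate.spow_rel_of_touch_mem hB' +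
      (z + x) * z * x * hB₂ - (x + y) ^ 2 * x * hC₂
  obtain ⟨α, β, γ, hsum, rfl⟩ := h.exists_bary U
  have hsum0 : α + β + γ ≠ 0 := by rw [hsum]; exact one_ne_zero
  have e₁ := h.spow_bary_eq c₁ hsum0
  have e₂ := h.spow_bary_eq c₂ hsum0
  have e₃ := h.spow_bary_eq O hsum0
  rw [hsum] at e₁ e₂ e₃
  rw [spow_eq_zero_of_mem hAO, spow_eq_zero_of_mem hBO, spow_eq_zero_of_mem hCO] at e₃
  have f₁ : α * spow c₁ A + β * spow c₁ B + γ * spow c₁ C = 0 := by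
    linear_combination e₃ - e₁ + hU.2
  have f₂ : α * spow c₂ A + β * spow c₂ B + γ * spow c₂ C = 0 := by
    linear_combination e₃ - e₂ + hU.2 - hU.1
  rw [hA₁] at f₁
  obtain rfl : α = 0 := by
    have h1 : 0 < (y + z) * (2 * x + y + z) * ((z + x) * (x + y)) +
      (z + x) * (x + y) * x ^ 2 := by positivity
    refine (mul_eq_zero.1 ?_).resolve_right h1.ne'
    linear_combination (y + z) * (2 * x + y + z) * (f₁ - f₂) - (y + z) * β * (hB₁ - hB₂) -
      (y + z) * γ * (hC₁ - hC₂) + α * hA₂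
  have f : β * ((x + y) * y) + γ * ((z + x) * z) = 0 := by
    apply mul_left_cancel₀ (show y + z ≠ 0 by positivity)
    linear_combination (2 * x + y + z) * f₁ - β * hB₁ - γ * hC₁
  have hk : (z + x) * z - (x + y) * y ≠ 0 := by
    have h1 := mul_ne_zero (sub_ne_zero.2 hyz.symm) (show x + y + z ≠ 0 by positivity)
    convert h1 using 1
    ring
  rw [← bary_smul A B C hk]
  congr 1
  · ring
  · linear_combination (z + x) * z * hsum - f
  · linear_combination (-((x + y) * y)) * hsum + f

theorem radical_center_mem (h : IsRavi A B C x y z) {s : Sphere Pt} (hA : A ∈ s)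
    (hX : bary A B C 0 (z + x) (x + y) ∈ s)
    (hA' : bary A B C (-(y + z) * y * z) ((z + x) ^ 2 * z) ((x + y) ^ 2 * y) ∈ s) :
    bary A B C 0 ((z + x) * z) (-((x + y) * y)) ∈ s := by
  have hyz := h.ne_of_touch_mem hA hX hA'
  have hx := h.pos_x
  have hy := h.pos_y
  have hz := h.pos_z
  have h1 := h.spow_rel_of_touch_mem hA'
  have h2 := h.spow_rel_of_bisector_foot_mem hX
  rw [spow_eq_zero_of_mem hA, mul_zero] at h1
  have hk : 0 + (z + x) * z + -((x + y) * y) ≠ 0 := by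
    have h1 := mul_ne_zero (sub_ne_zero.2 hyz.symm) (show x + y + z ≠ 0 by positivity)
    convert h1 using 1
    ring
  have hB : (2 * x + y + z) * ((x + y) * y - (z + x) * z) * spow s B =
      (y + z) ^ 2 * (x + y) ^ 2 * y := by
    apply mul_left_cancel₀ (show z + x ≠ 0 by positivity)
    linear_combination (x + y) * y * h2 - (2 * x + y + z) * h1
  have hC : (2 * x + y + z) * ((z + x) * z - (x + y) * y) * spow s C =
      (y + z) ^ 2 * (z + x) ^ 2 * z := by
    apply mul_left_cancel₀ (show x + y ≠ 0 by positivity)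
    linear_combination (z + x) * z * h2 - (2 * x + y + z) * h1
  have h3 := h.spow_bary_eq s hk
  refine mem_of_spow_eq_zero hX ((mul_eq_zero.1 ?_).resolve_left
    (mul_ne_zero (show 2 * x + y + z ≠ 0 by positivity) (pow_ne_zero 2 hk)))
  linear_combination (2 * x + y + z) * h3 - (z + x) * z * hB - (x + y) * y * hC

theorem collinear_radical_centers (h : IsRavi A B C x y z) (hxy : x ≠ y) (hyz : y ≠ z)
    (hzx : z ≠ x) : Collinear ℝ ({bary A B C 0 ((z + x) * z) (-((x + y) * y)),
      bary B C A 0 ((x + y) * x) (-((y + z) * z)),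
      bary C A B 0 ((y + z) * y) (-((z + x) * x))} : Set Pt) := by
  have hx := h.pos_x
  have hy := h.pos_y
  have hz := h.pos_z
  have ne_zero {p q r : ℝ} (hp : 0 < p) (hq : 0 < q) (hr : 0 < r) (hqr : q ≠ r) :
      (r + p) * r - (p + q) * q ≠ 0 := by
    have h1 := mul_ne_zero (sub_ne_zero.2 hqr.symm) (show p + q + r ≠ 0 by positivity)
    convert h1 using 1
    ring
  have hU := ne_zero hx hy hz hyz
  have hV := ne_zero hy hz hx hzx
  have hW := ne_zero hz hx hy hxy
  apply collinear_insert_of_mem_affineSpan_pair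
  convert AffineMap.lineMap_mem_affineSpan_pair
    (-(z * ((y + z) * y - (z + x) * x)) / (x * ((z + x) * z - (x + y) * y))) _ _ using 1
  ext i
  simp only [lineMap_apply_coord, bary_apply, zero_add, zero_mul, ← sub_eq_add_neg]
  have hsum : x * ((z + x) * z - (x + y) * y) + y * ((x + y) * x - (y + z) * z) +
    z * ((y + z) * y - (z + x) * x) = 0 := by ring
  generalize (z + x) * z - (x + y) * y = u at *
  generalize (x + y) * x - (y + z) * z = v at *
  generalize (y + z) * y - (z + x) * x = w at *
  have ht : 1 - -(z * w) / (x * u) = -(y * v) / (x * u) := by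
    field_simp
    linear_combination hsum
  rw [ht]
  field_simp
  ring

end IsRavi

/-- Lemma 6. With `D,E,F` the incircle touch points, `M',N',P'` the opposite arc
midpoints, and `A',B',C'` the tangency points of the mixtilinear incircles with the
circumcircle: the quadruples `(A',M',X,D)`, `(B',N',Y,E)`, `(C',P',Z,F)` and `(B',C',X,D)`,
`(C',A',Y,E)`, `(A',B',Z,F)` are concyclic, the radical centers `U,V,W` of the corresponding
circle pairs with the circumcircle are collinear, and `U,V,W` lie on the circles `(AXA')`,
`(BYB')`, `(CZC')`. -/
theorem stmt_5
    (A B C : Pt) (hABC : AffineIndependent ℝ ![A, B, C])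
    (a b c : ℝ) (ha : a = dist B C) (hb : b = dist C A) (hc : c = dist A B)
    (I : Pt) (hI : I = incenterPt A B C)
    (D E F : Pt)
    (hD₁ : D ∈ line[ℝ, B, C]) (hD₂ : ⟪D - I, C - B⟫ = 0)
    (hE₁ : E ∈ line[ℝ, C, A]) (hE₂ : ⟪E - I, A - C⟫ = 0)
    (hF₁ : F ∈ line[ℝ, A, B]) (hF₂ : ⟪F - I, B - A⟫ = 0)
    (X Y Z : Pt)
    (hX : X = bary A B C 0 b c) (hY : Y = bary A B C a 0 c) (hZ : Z = bary A B C a b 0)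
    (O : Sphere Pt) (hAO : A ∈ O) (hBO : B ∈ O) (hCO : C ∈ O)
    (M' N' P' : Pt)
    (hM' : M' ∈ O ∧ M' ∈ line[ℝ, A, I] ∧ M' ≠ A)
    (hN' : N' ∈ O ∧ N' ∈ line[ℝ, B, I] ∧ N' ≠ B)
    (hP' : P' ∈ O ∧ P' ∈ line[ℝ, C, I] ∧ P' ≠ C)
    -- the mixtilinear incircles and their tangency points with the circumcircle
    (Ka Kb Kc : Sphere Pt) (A' B' C' : Pt)
    (hKa₁ : TangentLine Ka line[ℝ, A, B]) (hKa₂ : TangentLine Ka line[ℝ, A, C])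
    (hKa₃ : dist O.center Ka.center = O.radius - Ka.radius) (hKa₄ : A' ∈ Ka) (hKa₅ : A' ∈ O)
    (hKb₁ : TangentLine Kb line[ℝ, B, C]) (hKb₂ : TangentLine Kb line[ℝ, B, A])
    (hKb₃ : dist O.center Kb.center = O.radius - Kb.radius) (hKb₄ : B' ∈ Kb) (hKb₅ : B' ∈ O)
    (hKc₁ : TangentLine Kc line[ℝ, C, A]) (hKc₂ : TangentLine Kc line[ℝ, C, B])
    (hKc₃ : dist O.center Kc.center = O.radius - Kc.radius) (hKc₄ : C' ∈ Kc) (hKc₅ : C' ∈ O)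
    -- the circles through each of the triples
    (c₁ c₂ c₃ c₄ c₅ c₆ : Sphere Pt)
    (hc₁ : A' ∈ c₁ ∧ M' ∈ c₁ ∧ X ∈ c₁) (hc₂ : B' ∈ c₂ ∧ C' ∈ c₂ ∧ X ∈ c₂)
    (hc₃ : B' ∈ c₃ ∧ N' ∈ c₃ ∧ Y ∈ c₃) (hc₄ : C' ∈ c₄ ∧ A' ∈ c₄ ∧ Y ∈ c₄)
    (hc₅ : C' ∈ c₅ ∧ P' ∈ c₅ ∧ Z ∈ c₅) (hc₆ : A' ∈ c₆ ∧ B' ∈ c₆ ∧ Z ∈ c₆)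
    -- the radical centers of the circle pairs with the circumcircle
    (U V W : Pt)
    (hU : spow c₁ U = spow c₂ U ∧ spow c₁ U = spow O U)
    (hV : spow c₃ V = spow c₄ V ∧ spow c₃ V = spow O V)
    (hW : spow c₅ W = spow c₆ W ∧ spow c₅ W = spow O W)
    -- the circles (AXA'), (BYB'), (CZC')
    (sA sB sC : Sphere Pt)
    (hsA : A ∈ sA ∧ X ∈ sA ∧ A' ∈ sA)
    (hsB : B ∈ sB ∧ Y ∈ sB ∧ B' ∈ sB)
    (hsC : C ∈ sC ∧ Z ∈ sC ∧ C' ∈ sC) :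
    (EuclideanGeometry.Concyclic ({A', M', X, D} : Set Pt) ∧ D ∈ c₁) ∧
    (EuclideanGeometry.Concyclic ({B', N', Y, E} : Set Pt) ∧ E ∈ c₃) ∧
    (EuclideanGeometry.Concyclic ({C', P', Z, F} : Set Pt) ∧ F ∈ c₅) ∧
    (EuclideanGeometry.Concyclic ({B', C', X, D} : Set Pt) ∧ D ∈ c₂) ∧
    (EuclideanGeometry.Concyclic ({C', A', Y, E} : Set Pt) ∧ E ∈ c₄) ∧
    (EuclideanGeometry.Concyclic ({A', B', Z, F} : Set Pt) ∧ F ∈ c₆) ∧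
    Collinear ℝ ({U, V, W} : Set Pt) ∧
    U ∈ sA ∧ V ∈ sB ∧ W ∈ sC := by
  have hN : ¬ Collinear ℝ ({A, B, C} : Set Pt) := affineIndependent_iff_not_collinear_set.1 hABC
  obtain ⟨x, y, z, h⟩ : ∃ x y z, IsRavi A B C x y z := ⟨_, _, _, IsRavi.of_not_collinear hN⟩
  have h' := h.rotate
  have h'' := h'.rotate
  rw [h.dist_BC] at ha
  rw [h.dist_CA] at hb
  rw [h.dist_AB] at hc
  subst ha hb hc
  rw [bary_rotate] at hY
  rw [bary_rotate, bary_rotate] at hZ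
  have hI' : I = incenterPt B C A := hI.trans (incenterPt_rotate A B C)
  have hI'' : I = incenterPt C A B := hI'.trans (incenterPt_rotate B C A)
  have eD := h.eq_bary_incircle_touch hD₁ (hI ▸ hD₂)
  have eE := h'.eq_bary_incircle_touch hE₁ (hI' ▸ hE₂)
  have eF := h''.eq_bary_incircle_touch hF₁ (hI'' ▸ hF₂)
  have eM := h.eq_bary_arc_midpoint hAO hBO hCO hM'.1 (hI ▸ hM'.2.1) hM'.2.2
  have eN := h'.eq_bary_arc_midpoint hBO hCO hAO hN'.1 (hI' ▸ hN'.2.1) hN'.2.2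
  have eP := h''.eq_bary_arc_midpoint hCO hAO hBO hP'.1 (hI'' ▸ hP'.2.1) hP'.2.2
  clear hD₁ hD₂ hE₁ hE₂ hF₁ hF₂ hM' hN' hP' hI hI' hI''
  subst hX hY hZ eD eE eF eM eN eP
  obtain rfl := (h.mixtilinear_touch hAO hBO hCO hKa₁ hKa₂ hKa₃ hKa₄ hKa₅).resolve_left
    (h.mixtilinear_touch_ne hc₁.1 hc₁.2.1 hc₁.2.2)
  obtain rfl := (h'.mixtilinear_touch hBO hCO hAO hKb₁ hKb₂ hKb₃ hKb₄ hKb₅).resolve_left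
    (h'.mixtilinear_touch_ne hc₃.1 hc₃.2.1 hc₃.2.2)
  obtain rfl := (h''.mixtilinear_touch hCO hAO hBO hKc₁ hKc₂ hKc₃ hKc₄ hKc₅).resolve_left
    (h''.mixtilinear_touch_ne hc₅.1 hc₅.2.1 hc₅.2.2)
  have hyz := h.ne_of_touch_mem hsA.1 hsA.2.1 hsA.2.2
  have hzx := h'.ne_of_touch_mem hsB.1 hsB.2.1 hsB.2.2
  have hxy := h''.ne_of_touch_mem hsC.1 hsC.2.1 hsC.2.2
  have hD₁ := (h.spow_of_ratio hc₁.2.2 (h.spow_ratio_of_touch_arc_midpoint hyz hc₁.1 hc₁.2.1)).2.2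
  have hE₃ := (h'.spow_of_ratio hc₃.2.2
    (h'.spow_ratio_of_touch_arc_midpoint hzx hc₃.1 hc₃.2.1)).2.2
  have hF₅ := (h''.spow_of_ratio hc₅.2.2
    (h''.spow_ratio_of_touch_arc_midpoint hxy hc₅.1 hc₅.2.1)).2.2
  have hD₂ := (h.spow_of_ratio hc₂.2.2 (h.spow_ratio_of_touch_touch hc₂.1 hc₂.2.1)).2.2
  have hE₄ := (h'.spow_of_ratio hc₄.2.2 (h'.spow_ratio_of_touch_touch hc₄.1 hc₄.2.1)).2.2
  have hF₆ := (h''.spow_of_ratio hc₆.2.2 (h''.spow_ratio_of_touch_touch hc₆.1 hc₆.2.1)).2.2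
  obtain rfl := h.eq_bary_radical_center hyz hAO hBO hCO hc₁.1 hc₁.2.1 hc₁.2.2
    hc₂.1 hc₂.2.1 hc₂.2.2 hU
  obtain rfl := h'.eq_bary_radical_center hzx hBO hCO hAO hc₃.1 hc₃.2.1 hc₃.2.2
    hc₄.1 hc₄.2.1 hc₄.2.2 hV
  obtain rfl := h''.eq_bary_radical_center hxy hCO hAO hBO hc₅.1 hc₅.2.1 hc₅.2.2
    hc₆.1 hc₆.2.1 hc₆.2.2 hW
  exact ⟨⟨concyclic_of_mem hc₁.1 hc₁.2.1 hc₁.2.2 hD₁, hD₁⟩,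
    ⟨concyclic_of_mem hc₃.1 hc₃.2.1 hc₃.2.2 hE₃, hE₃⟩,
    ⟨concyclic_of_mem hc₅.1 hc₅.2.1 hc₅.2.2 hF₅, hF₅⟩,
    ⟨concyclic_of_mem hc₂.1 hc₂.2.1 hc₂.2.2 hD₂, hD₂⟩,
    ⟨concyclic_of_mem hc₄.1 hc₄.2.1 hc₄.2.2 hE₄, hE₄⟩,
    ⟨concyclic_of_mem hc₆.1 hc₆.2.1 hc₆.2.2 hF₆, hF₆⟩,
    h.collinear_radical_centers hxy hyz hzx,
    h.radical_center_mem hsA.1 hsA.2.1 hsA.2.2,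
    h'.radical_center_mem hsB.1 hsB.2.1 hsB.2.2,
    h''.radical_center_mem hsC.1 hsC.2.1 hsC.2.2⟩
end
end

section
/- Let ABC be a triangle with incenter I and side lengths a = BC, b = CA, c = AB. The orthotransversal of triangle ABC with respect to the incenter I (the line through the collinear intersections of the perpendiculars at I to AI, BI, CI with the sidelines BC, CA, AB) is the tripolar of the point with barycentric coordinates (a/(b+c−a) : b/(c+a−b) : c/(a+b−c)); i.e., the orthocorrespondent of the incenter is I^⊥ = (a/(b+c−a) : b/(c+a−b) : c/(a+b−c)), the Kimberling center X₅₇. -/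
open EuclideanGeometry RealInnerProductSpace Real

noncomputable section

/-- If the line through `I` and `U = (1 - t) B + t C` is perpendicular to `AI`, where `I` is the
incenter, then the barycentric coordinates `(0 : 1 - t : t)` of `U` satisfy the equation of the
tripolar of `X₅₇`. -/
lemma tripolar_eq_of_inner_incenterPt_eq_zero (A B C : Pt) (t : ℝ)
    (hb : 0 < dist C A) (hc : 0 < dist A B) (h : dist B C < dist C A + dist A B)
    (hU : ⟪AffineMap.lineMap B C t - incenterPt A B C, A - incenterPt A B C⟫ = 0) :
    (1 - t) / (dist C A / (dist A B + dist B C - dist C A)) +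
      t / (dist A B / (dist B C + dist C A - dist A B)) = 0 := by
  have ha : 0 ≤ dist B C := dist_nonneg
  have hpp : ⟪B - A, B - A⟫ = dist A B ^ 2 := by
    rw [real_inner_self_eq_norm_sq, dist_comm, dist_eq_norm]
  have hqq : ⟪C - A, C - A⟫ = dist C A ^ 2 := by
    rw [real_inner_self_eq_norm_sq, dist_eq_norm]
  have hpq : ⟪B - A, C - A⟫ = (dist A B ^ 2 + dist C A ^ 2 - dist B C ^ 2) / 2 := by
    have h1 : ⟪(B - A) - (C - A), (B - A) - (C - A)⟫ = dist B C ^ 2 := by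
      rw [real_inner_self_eq_norm_sq, sub_sub_sub_cancel_right, dist_eq_norm]
    rw [real_inner_sub_sub_self, hpp, hqq] at h1
    linarith
  unfold incenterPt bary at hU
  generalize dist B C = a at *
  generalize dist C A = b at *
  generalize dist A B = c at *
  have hs : 0 < a + b + c := by linarith
  have hUI : AffineMap.lineMap B C t - (a + b + c)⁻¹ • (a • A + b • B + c • C) =
      ((1 - t) - b / (a + b + c)) • (B - A) + (t - c / (a + b + c)) • (C - A) := by
    ext i
    simp [AffineMap.lineMap_apply]
    field_simp
    ring
  have hAI : A - (a + b + c)⁻¹ • (a • A + b • B + c • C) =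
      (-(b / (a + b + c))) • (B - A) + (-(c / (a + b + c))) • (C - A) := by
    ext i
    simp
    field_simp
    ring
  have hqp := (real_inner_comm (B - A) (C - A)).trans hpq
  rw [hUI, hAI] at hU
  simp only [inner_add_left, inner_add_right, real_inner_smul_left, real_inner_smul_right,
    hpp, hqq, hpq, hqp] at hU
  have key : ((b + c) ^ 2 - a ^ 2) *
      ((1 - t) * c * (c + a - b) + t * b * (a + b - c)) = 0 := by
    field_simp at hU
    linear_combination -hU
  have hne : (b + c) ^ 2 - a ^ 2 ≠ 0 := by nlinarith
  have := (mul_eq_zero.mp key).resolve_left hne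
  rw [div_div_eq_mul_div, div_div_eq_mul_div]
  field_simp
  linarith

/-- The tripolar of a point is contained in a line. -/
lemma collinear_tripolarSet (A B C : Pt) {u : ℝ} (hu : u ≠ 0) (v w : ℝ) :
    Collinear ℝ (tripolarSet A B C u v w) := by
  rcases (tripolarSet A B C u v w).eq_empty_or_nonempty with h | ⟨S₀, hS₀⟩
  · rw [h]
    exact collinear_empty ℝ Pt
  rw [collinear_iff_of_mem hS₀]
  obtain ⟨x₀, y₀, z₀, h₀, rfl, e₀⟩ := hS₀
  have hp : u⁻¹ ≠ 0 := inv_ne_zero hu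
  simp only [div_eq_mul_inv] at e₀
  refine ⟨(w⁻¹ - v⁻¹) • A + (u⁻¹ - w⁻¹) • B + (v⁻¹ - u⁻¹) • C, ?_⟩
  rintro _ ⟨x, y, z, h, rfl, e⟩
  simp only [div_eq_mul_inv] at e
  generalize u⁻¹ = p at *
  generalize v⁻¹ = q at *
  generalize w⁻¹ = r at *
  obtain ⟨k, hx, hy, hz⟩ : ∃ k : ℝ,
      x / (x + y + z) = k * (r - q) + x₀ / (x₀ + y₀ + z₀) ∧
      y / (x + y + z) = k * (p - r) + y₀ / (x₀ + y₀ + z₀) ∧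
      z / (x + y + z) = k * (q - p) + z₀ / (x₀ + y₀ + z₀) := by
    have s : x / (x + y + z) + y / (x + y + z) + z / (x + y + z) = 1 := by field_simp
    have s₀ : x₀ / (x₀ + y₀ + z₀) + y₀ / (x₀ + y₀ + z₀) + z₀ / (x₀ + y₀ + z₀) = 1 := by
      field_simp
    have f : x / (x + y + z) * p + y / (x + y + z) * q + z / (x + y + z) * r = 0 := by
      field_simp
      linarith
    have f₀ : x₀ / (x₀ + y₀ + z₀) * p + y₀ / (x₀ + y₀ + z₀) * q +
        z₀ / (x₀ + y₀ + z₀) * r = 0 := by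
      field_simp
      linarith
    generalize x / (x + y + z) = X at *
    generalize y / (x + y + z) = Y at *
    generalize z / (x + y + z) = Z at *
    generalize x₀ / (x₀ + y₀ + z₀) = X₀ at *
    generalize y₀ / (x₀ + y₀ + z₀) = Y₀ at *
    generalize z₀ / (x₀ + y₀ + z₀) = Z₀ at *
    obtain rfl : X = 1 - Y - Z := by linarith
    obtain rfl : X₀ = 1 - Y₀ - Z₀ := by linarith
    by_cases h1 : p - r = 0
    · have h2 : q - p ≠ 0 := by
        intro h2
        obtain rfl : p = r := by linarith
        obtain rfl : q = p := by linarith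
        exact hp (by linarith)
      have hY : Y = Y₀ := by
        apply mul_right_cancel₀ h2
        obtain rfl : p = r := by linarith
        linarith
      refine ⟨(Z - Z₀) / (q - p), ?_, ?_, ?_⟩ <;> field_simp
      · rw [hY]; linear_combination (Z - Z₀) * h1
      · rw [hY]; linear_combination (Z₀ - Z) * h1
      · ring
    · refine ⟨(Y - Y₀) / (p - r), ?_, ?_, ?_⟩ <;> field_simp
      · linear_combination f - f₀
      · ring
      · linear_combination f₀ - f
  refine ⟨k, ?_⟩
  have expand (x y z : ℝ) : bary A B C x y z =
      (x / (x + y + z)) • A + (y / (x + y + z)) • B + (z / (x + y + z)) • C := by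
    simp only [bary, smul_add, smul_smul, div_eq_inv_mul]
  rw [expand, expand, hx, hy, hz, vadd_eq_add]
  module

/-- The strict triangle inequality for a nondegenerate triangle. -/
lemma dist_lt_dist_add_dist_of_not_collinear {A B C : Pt} (h : ¬ Collinear ℝ {A, B, C}) :
    dist A C < dist A B + dist B C :=
  dist_lt_dist_add_dist_iff.mpr fun hw => h hw.collinear

/-- The orthotransversal of the incenter `I` (through the intersections `U, V, W`
of the perpendiculars at `I` to `AI`, `BI`, `CI` with the sidelines) is the tripolar of the
point `I^⊥ = (a/(b+c−a) : b/(c+a−b) : c/(a+b−c))`, the Kimberling center `X₅₇`. -/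
theorem stmt_13
    (A B C : Pt) (hABC : AffineIndependent ℝ ![A, B, C])
    (a b c : ℝ) (ha : a = dist B C) (hb : b = dist C A) (hc : c = dist A B)
    (I : Pt) (hI : I = incenterPt A B C)
    (U V W : Pt)
    (hU₁ : U ∈ line[ℝ, B, C]) (hU₂ : ⟪U - I, A - I⟫ = 0)
    (hV₁ : V ∈ line[ℝ, C, A]) (hV₂ : ⟪V - I, B - I⟫ = 0)
    (hW₁ : W ∈ line[ℝ, A, B]) (hW₂ : ⟪W - I, C - I⟫ = 0) :
    Collinear ℝ ({U, V, W} : Set Pt) ∧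
    U ∈ tripolarSet A B C (a/(b+c-a)) (b/(c+a-b)) (c/(a+b-c)) ∧
    V ∈ tripolarSet A B C (a/(b+c-a)) (b/(c+a-b)) (c/(a+b-c)) ∧
    W ∈ tripolarSet A B C (a/(b+c-a)) (b/(c+a-b)) (c/(a+b-c)) := by
  have hcol : ¬ Collinear ℝ {A, B, C} := affineIndependent_iff_not_collinear_set.mp hABC
  have tb := dist_lt_dist_add_dist_of_not_collinear hcol
  have tc := dist_lt_dist_add_dist_of_not_collinear (A := A) (B := C) (C := B)
    (by rwa [Set.pair_comm C B])
  have ta := dist_lt_dist_add_dist_of_not_collinear (A := B) (B := A) (C := C)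
    (by rwa [Set.insert_comm])
  rw [dist_comm A C] at tb tc ta
  rw [dist_comm C B] at tc
  rw [dist_comm B A] at ta
  have ha₀ : 0 < dist B C := by linarith
  have hb₀ : 0 < dist C A := by linarith
  have hc₀ : 0 < dist A B := by linarith
  have hI' : incenterPt B C A = incenterPt A B C := by
    ext i
    simp [incenterPt, bary]
    ring
  have hI'' : incenterPt C A B = incenterPt A B C := by
    ext i
    simp [incenterPt, bary]
    ring
  subst hI
  obtain ⟨t, rfl⟩ := mem_affineSpan_pair_iff_exists_lineMap_eq.mp hU₁
  obtain ⟨r, rfl⟩ := mem_affineSpan_pair_iff_exists_lineMap_eq.mp hV₁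
  obtain ⟨s, rfl⟩ := mem_affineSpan_pair_iff_exists_lineMap_eq.mp hW₁
  have eU := tripolar_eq_of_inner_incenterPt_eq_zero A B C t hb₀ hc₀ (by linarith) hU₂
  have eV := tripolar_eq_of_inner_incenterPt_eq_zero B C A r hc₀ ha₀ (by linarith)
    (by rw [hI']; exact hV₂)
  have eW := tripolar_eq_of_inner_incenterPt_eq_zero C A B s ha₀ hb₀ (by linarith)
    (by rw [hI'']; exact hW₂)
  simp only [← ha, ← hb, ← hc] at ta tb tc ha₀ eU eV eW
  have mU : AffineMap.lineMap B C t ∈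
      tripolarSet A B C (a/(b+c-a)) (b/(c+a-b)) (c/(a+b-c)) :=
    ⟨0, 1 - t, t, by simp, by simp [bary, AffineMap.lineMap_apply_module],
      by rw [zero_div]; linarith⟩
  have mV : AffineMap.lineMap C A r ∈
      tripolarSet A B C (a/(b+c-a)) (b/(c+a-b)) (c/(a+b-c)) :=
    ⟨r, 0, 1 - r, by simp, by simp [bary, AffineMap.lineMap_apply_module, add_comm],
      by rw [zero_div]; linarith⟩
  have mW : AffineMap.lineMap A B s ∈
      tripolarSet A B C (a/(b+c-a)) (b/(c+a-b)) (c/(a+b-c)) :=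
    ⟨1 - s, s, 0, by simp, by simp [bary, AffineMap.lineMap_apply_module],
      by rw [zero_div]; linarith⟩
  have hu : a / (b + c - a) ≠ 0 := (div_pos ha₀ (by linarith)).ne'
  refine ⟨(collinear_tripolarSet A B C hu (b/(c+a-b)) (c/(a+b-c))).subset ?_, mU, mV, mW⟩
  rintro _ (rfl | rfl | rfl) <;> assumption
end
end

section
/- Let ABC be an acute triangle with circumcenter O, circumcircle 𝒪, orthocenter H, and Euler line OH. Let O_a, O_b, O_c be the centers of the three Apollonius circles of ABC, i.e., the intersections of the tangents to the circumcircle at A, B, C with the opposite sidelines BC, CA, AB. Let 𝒫_a, 𝒫_b, 𝒫_c be the circles with diameters AO_a, BO_b, CO_c. Then 𝒫_a, 𝒫_b, 𝒫_c are coaxal with the Euler line OH as their common radical axis, and they intersect at two points L, L′ on the Euler line; moreover the power of H with respect to each of 𝒫_a, 𝒫_b, 𝒫_c equals half the power of H with respect to the circumcircle, and the power of O with respect to each equals the square of the circumradius. -/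
open EuclideanGeometry RealInnerProductSpace Real

noncomputable section

lemma Pt.inner_eq (u v : Pt) : ⟪u, v⟫ = u 0 * v 0 + u 1 * v 1 := by
  simp [PiLp.inner_apply, Fin.sum_univ_two]
  ring

lemma Pt.dist_sq_eq_inner (p q : Pt) : dist p q ^ 2 = ⟪p - q, p - q⟫ := by
  rw [dist_eq_norm, real_inner_self_eq_norm_sq]

lemma Pt.ext_coords {p q : Pt} (h₀ : p 0 = q 0) (h₁ : p 1 = q 1) : p = q := by
  ext i
  fin_cases i <;> assumption

lemma Pt.exists_eq_smul {u v : Pt} (hv : v ≠ 0) (h : u 0 * v 1 - u 1 * v 0 = 0) :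
    ∃ k : ℝ, u = k • v := by
  have hv' := (real_inner_self_pos.2 hv).ne'
  refine ⟨⟪u, v⟫ / ⟪v, v⟫, ?_⟩
  rw [div_eq_inv_mul, mul_smul, eq_inv_smul_iff₀ hv']
  simp only [Pt.inner_eq]
  apply Pt.ext_coords <;> simp only [PiLp.smul_apply, smul_eq_mul]
  · linear_combination v 1 * h
  · linear_combination -v 0 * h

lemma spow_diameter (A Q P : Pt) :
    spow ⟨midpoint ℝ A Q, dist A Q / 2⟩ P = ⟪P - A, P - Q⟫ := by
  simp only [spow, div_pow, Pt.dist_sq_eq_inner, midpoint_eq_smul_add, Pt.inner_eq, PiLp.sub_apply,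
    PiLp.smul_apply, PiLp.add_apply, smul_eq_mul, invOf_eq_inv]
  ring

lemma mem_sphere_of_spow_eq_zero {s : EuclideanGeometry.Sphere Pt} {p : Pt} (hs : 0 ≤ s.radius)
    (h : spow s p = 0) : p ∈ s := by
  rw [EuclideanGeometry.mem_sphere]
  exact (sq_eq_sq₀ dist_nonneg hs).1 (sub_eq_zero.1 h)

/-- The radical axis of two non-concentric circles is the line through any two of its points. -/
lemma radAxis_eq_line {s t : EuclideanGeometry.Sphere Pt} {p q : Pt} (hst : s.center ≠ t.center)
    (hpq : p ≠ q) (hp : spow s p = spow t p) (hq : spow s q = spow t q) :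
    radAxis s t = (line[ℝ, p, q] : Set Pt) := by
  have key (x : Pt) : (spow s x - spow t x) - (spow s p - spow t p) =
      2 * ⟪x - p, t.center - s.center⟫ := by
    simp only [spow, Pt.dist_sq_eq_inner, Pt.inner_eq, PiLp.sub_apply]
    ring
  have hq' : ⟪q - p, t.center - s.center⟫ = 0 := by linarith [key q]
  ext x
  have hx : x ∈ radAxis s t ↔ ⟪x - p, t.center - s.center⟫ = 0 := by
    change spow s x = spow t x ↔ _
    constructor <;> intro h <;> linarith [key x]
  rw [hx, SetLike.mem_coe]
  constructor
  · intro h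
    have hd : t.center - s.center ≠ 0 := sub_ne_zero.2 hst.symm
    have hcross : (x - p) 0 * (q - p) 1 - (x - p) 1 * (q - p) 0 = 0 := by
      have hd' := (real_inner_self_pos.2 hd).ne'
      rw [Pt.inner_eq] at hd' h hq'
      refine (mul_eq_zero.1 ?_).resolve_right hd'
      set d := t.center - s.center
      linear_combination ((q - p) 1 * d 0 - (q - p) 0 * d 1) * h +
        ((x - p) 0 * d 1 - (x - p) 1 * d 0) * hq'
    obtain ⟨k, hk⟩ := Pt.exists_eq_smul (sub_ne_zero.2 hpq.symm) hcross
    rw [show x = AffineMap.lineMap p q k by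
      rw [AffineMap.lineMap_apply, vsub_eq_sub, ← hk, vadd_eq_add, sub_add_cancel]]
    exact AffineMap.lineMap_mem_affineSpan_pair _ _ _
  · intro h
    obtain ⟨k, rfl⟩ := mem_affineSpan_pair_iff_exists_lineMap_eq.1 h
    rw [AffineMap.lineMap_apply, vsub_eq_sub, vadd_eq_add, add_sub_cancel_right,
      real_inner_smul_left, hq', mul_zero]

/-- A line through a point interior to a circle meets the circle in two points. -/
lemma exists_two_spow_eq_zero {s : EuclideanGeometry.Sphere Pt} {p q : Pt} (hpq : p ≠ q)
    (hq : spow s q < 0) :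
    ∃ l l' : Pt, l ≠ l' ∧ spow s l = 0 ∧ spow s l' = 0 ∧ l ∈ line[ℝ, p, q] ∧
      l' ∈ line[ℝ, p, q] := by
  have hv : q - p ≠ 0 := sub_ne_zero.2 hpq.symm
  have hα : 0 < ⟪q - p, q - p⟫ := real_inner_self_pos.2 hv
  set α := ⟪q - p, q - p⟫ with hα_def
  set β := ⟪q - p, q - s.center⟫ with hβ_def
  have hpow (t : ℝ) : spow s (AffineMap.lineMap p q (1 + t)) =
      α * t ^ 2 + 2 * β * t + spow s q := by
    simp only [hα_def, hβ_def, spow, Pt.dist_sq_eq_inner, Pt.inner_eq, AffineMap.lineMap_apply,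
      vsub_eq_sub, vadd_eq_add, PiLp.sub_apply, PiLp.add_apply, PiLp.smul_apply, smul_eq_mul]
    ring
  have hdisc : 0 < β ^ 2 - α * spow s q := by nlinarith [sq_nonneg β]
  set δ := √(β ^ 2 - α * spow s q)
  have hδ : 0 < δ := Real.sqrt_pos.2 hdisc
  have hδ_sq : δ ^ 2 = β ^ 2 - α * spow s q := Real.sq_sqrt hdisc.le
  refine ⟨AffineMap.lineMap p q (1 + (-β + δ) / α), AffineMap.lineMap p q (1 + (-β - δ) / α),
    ?_, ?_, ?_, AffineMap.lineMap_mem_affineSpan_pair _ _ _,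
    AffineMap.lineMap_mem_affineSpan_pair _ _ _⟩
  · intro h
    have := AffineMap.lineMap_injective ℝ hpq h
    rw [add_right_inj, div_left_inj' hα.ne'] at this
    linarith
  · rw [hpow]
    field_simp
    linear_combination hδ_sq
  · rw [hpow]
    field_simp
    linear_combination hδ_sq

lemma det_ne_zero_of_affineIndependent {A B C : Pt} (h : AffineIndependent ℝ ![A, B, C]) :
    (B - A) 0 * (C - A) 1 - (B - A) 1 * (C - A) 0 ≠ 0 := by
  intro hdet
  have hBA : B ≠ A := fun e => by
    simpa using h.injective.ne (show (1 : Fin 3) ≠ 0 by decide) e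
  obtain ⟨k, hk⟩ := Pt.exists_eq_smul (u := C - A) (sub_ne_zero.2 hBA) (by linarith)
  rw [affineIndependent_iff_not_collinear_set] at h
  refine h ((collinear_iff_of_mem (p₀ := A) (by simp)).2 ⟨B - A, ?_⟩)
  simp only [Set.mem_insert_iff, Set.mem_singleton_iff, forall_eq_or_imp, forall_eq]
  exact ⟨⟨0, by simp⟩, ⟨1, by simp⟩, ⟨k, by rw [← hk, vadd_eq_add, sub_add_cancel]⟩⟩

lemma inner_eq_of_dist_eq {A B O : Pt} (h : dist O A = dist O B) :
    ⟪A - O, A - O⟫ = ⟪B - O, B - O⟫ := by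
  rw [← Pt.dist_sq_eq_inner, ← Pt.dist_sq_eq_inner, dist_comm A, dist_comm B, h]

/-- Sylvester's relation: the orthocenter is the sum of the vertices seen from the circumcenter. -/
lemma orthocenter_eq {A B C O H : Pt} (hABC : AffineIndependent ℝ ![A, B, C])
    (hAB : dist O A = dist O B) (hBC : dist O B = dist O C)
    (hH₁ : ⟪H - A, B - C⟫ = 0) (hH₂ : ⟪H - B, C - A⟫ = 0) :
    H = O + ((A - O) + (B - O) + (C - O)) := by
  have hdet := det_ne_zero_of_affineIndependent hABC
  have h₁ := inner_eq_of_dist_eq hAB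
  have h₂ := inner_eq_of_dist_eq hBC
  simp only [Pt.inner_eq, PiLp.sub_apply] at hdet h₁ h₂ hH₁ hH₂
  have e₁ : (H 0 - A 0 - (B 0 - O 0) - (C 0 - O 0)) * (B 0 - C 0) +
      (H 1 - A 1 - (B 1 - O 1) - (C 1 - O 1)) * (B 1 - C 1) = 0 := by
    linear_combination hH₁ - h₂
  have e₂ : (H 0 - A 0 - (B 0 - O 0) - (C 0 - O 0)) * (C 0 - A 0) +
      (H 1 - A 1 - (B 1 - O 1) - (C 1 - O 1)) * (C 1 - A 1) = 0 := by
    linear_combination hH₂ + h₁ + h₂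
  apply Pt.ext_coords <;> simp only [PiLp.add_apply, PiLp.sub_apply] <;>
    refine sub_eq_zero.1 ((mul_eq_zero.1 ?_).resolve_right hdet)
  · linear_combination (C 1 - A 1) * e₁ - (B 1 - C 1) * e₂
  · linear_combination -(C 0 - A 0) * e₁ + (B 0 - C 0) * e₂

lemma inner_sub_sub_pos_of_angle_lt {A B C : Pt} (h : ∠ B A C < π / 2) : 0 < ⟪B - A, C - A⟫ := by
  rw [EuclideanGeometry.angle, vsub_eq_sub, vsub_eq_sub, InnerProductGeometry.angle,
    Real.arccos_lt_pi_div_two] at h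
  by_contra! hle
  exact absurd h (not_lt.2 (div_nonpos_of_nonpos_of_nonneg hle (by positivity)))

/-- The orthocenter of an acute triangle lies inside the circumcircle. -/
lemma circumradius_sq_add_inner_neg {A B C O : Pt} (hABC : AffineIndependent ℝ ![A, B, C])
    (hA : ∠ B A C < π / 2) (hB : ∠ A B C < π / 2) (hC : ∠ B C A < π / 2)
    (hAB : dist O A = dist O B) (hBC : dist O B = dist O C) :
    ⟪A - O, A - O⟫ + ⟪B - O, C - O⟫ + ⟪C - O, A - O⟫ + ⟪A - O, B - O⟫ < 0 := by
  have hinj := hABC.injective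
  have hAB' : A ≠ B := fun e => by simpa using hinj.ne (show (0 : Fin 3) ≠ 1 by decide) e
  have hBC' : B ≠ C := fun e => by simpa using hinj.ne (show (1 : Fin 3) ≠ 2 by decide) e
  have hCA' : C ≠ A := fun e => by simpa using hinj.ne (show (2 : Fin 3) ≠ 0 by decide) e
  have pA := inner_sub_sub_pos_of_angle_lt hA
  have pB := inner_sub_sub_pos_of_angle_lt hB
  have pC := inner_sub_sub_pos_of_angle_lt hC
  have sAB := real_inner_self_pos.2 (sub_ne_zero.2 hAB')
  have sBC := real_inner_self_pos.2 (sub_ne_zero.2 hBC')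
  have sCA := real_inner_self_pos.2 (sub_ne_zero.2 hCA')
  have h₁ := inner_eq_of_dist_eq hAB
  have h₂ := inner_eq_of_dist_eq hBC
  generalize ha : A - O = a at *
  generalize hb : B - O = b at *
  generalize hc : C - O = c at *
  obtain rfl : A = a + O := by rw [← ha, sub_add_cancel]
  obtain rfl : B = b + O := by rw [← hb, sub_add_cancel]
  obtain rfl : C = c + O := by rw [← hc, sub_add_cancel]
  have gram : ⟪a, a⟫ * ⟪b, b⟫ * ⟪c, c⟫ + 2 * (⟪b, c⟫ * ⟪c, a⟫ * ⟪a, b⟫) - ⟪a, a⟫ * ⟪b, c⟫ ^ 2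
      - ⟪b, b⟫ * ⟪c, a⟫ ^ 2 - ⟪c, c⟫ * ⟪a, b⟫ ^ 2 = 0 := by
    simp only [Pt.inner_eq]
    ring
  simp only [add_sub_add_right_eq_sub, inner_sub_left, inner_sub_right, real_inner_comm b a,
    real_inner_comm c b, real_inner_comm a c, ← h₂, ← h₁] at *
  generalize ⟪a, a⟫ = r at *
  generalize ⟪b, c⟫ = x at *
  generalize ⟪c, a⟫ = y at *
  generalize ⟪a, b⟫ = z at *
  have hprod := mul_pos (mul_pos pA pB) pC
  have hsides := mul_pos (mul_pos sAB sBC) sCA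
  by_contra! hle
  nlinarith [mul_nonneg hle hsides.le]

/-- If `Q` lies on the tangent at `A` then `O` has power `R²` with respect to the circle on
diameter `AQ`. -/
lemma spow_circumcenter {A O Q : Pt} (hQ : ⟪Q - A, A - O⟫ = 0) :
    spow ⟨midpoint ℝ A Q, dist A Q / 2⟩ O = dist O A ^ 2 := by
  rw [spow_diameter, Pt.dist_sq_eq_inner]
  simp only [Pt.inner_eq, PiLp.sub_apply] at *
  linear_combination hQ

lemma inner_tangent_point {B C O Q : Pt} (hBC : dist O B = dist O C) (hQ : Q ∈ line[ℝ, B, C]) :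
    ⟪(B - O) + (C - O), Q - O⟫ = ⟪B - O, B - O⟫ + ⟪B - O, C - O⟫ := by
  obtain ⟨k, rfl⟩ := mem_affineSpan_pair_iff_exists_lineMap_eq.1 hQ
  have h := inner_eq_of_dist_eq hBC
  simp only [AffineMap.lineMap_apply, vsub_eq_sub, vadd_eq_add, Pt.inner_eq, PiLp.sub_apply,
    PiLp.add_apply, PiLp.smul_apply, smul_eq_mul] at *
  linear_combination -k * h

lemma spow_orthocenter {A B C O H Q : Pt} (hAB : dist O A = dist O B) (hBC : dist O B = dist O C)
    (hH : H = O + ((A - O) + (B - O) + (C - O))) (hQ : Q ∈ line[ℝ, B, C]) :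
    spow ⟨midpoint ℝ A Q, dist A Q / 2⟩ H = spow ⟨O, dist O A⟩ H / 2 := by
  have hQ' := inner_tangent_point hBC hQ
  have h₁ := inner_eq_of_dist_eq hAB
  have h₂ := inner_eq_of_dist_eq hBC
  rw [spow_diameter, spow, Pt.dist_sq_eq_inner, Pt.dist_sq_eq_inner, hH]
  simp only [Pt.inner_eq, PiLp.sub_apply, PiLp.add_apply] at *
  linear_combination -hQ' - h₂ / 2

/-- The circles on the diameters `AP` and `BQ`, with `P` and `Q` on the tangents at `A` and `B`
and on the opposite sides, are not concentric unless the triangle has a right angle. -/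
lemma midpoint_ne_midpoint {A B C O P Q : Pt} (hne : A ≠ B)
    (hAB : dist O A = dist O B) (hBC : dist O B = dist O C)
    (hsum : ⟪A - O, A - O⟫ + ⟪B - O, C - O⟫ + ⟪C - O, A - O⟫ + ⟪A - O, B - O⟫ ≠ 0)
    (hP : P ∈ line[ℝ, B, C]) (hPA : ⟪P - A, A - O⟫ = 0) (hQB : ⟪Q - B, B - O⟫ = 0) :
    midpoint ℝ A P ≠ midpoint ℝ B Q := by
  intro hmid
  have hP' := inner_tangent_point hBC hP
  have h₁ := inner_eq_of_dist_eq hAB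
  have h₂ := inner_eq_of_dist_eq hBC
  have hQ : Q = A + P - B := by
    rw [midpoint_eq_smul_add, midpoint_eq_smul_add] at hmid
    have := smul_right_injective Pt (isUnit_of_invertible (⅟2 : ℝ)).ne_zero hmid
    rw [eq_sub_iff_add_eq, add_comm]
    exact this.symm
  subst hQ
  have hpos := (real_inner_self_pos.2 (sub_ne_zero.2 hne)).ne'
  generalize ha : A - O = a at *
  generalize hb : B - O = b at *
  generalize hc : C - O = c at *
  generalize hp : P - O = p at *
  obtain rfl : A = a + O := by rw [← ha, sub_add_cancel]
  obtain rfl : B = b + O := by rw [← hb, sub_add_cancel]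
  obtain rfl : C = c + O := by rw [← hc, sub_add_cancel]
  obtain rfl : P = p + O := by rw [← hp, sub_add_cancel]
  have hsa : ⟪a + p, a⟫ = 2 * ⟪a, a⟫ := by
    simp only [Pt.inner_eq, PiLp.sub_apply, PiLp.add_apply] at *
    linear_combination hPA
  have hsb : ⟪a + p, b⟫ = 2 * ⟪a, a⟫ := by
    simp only [Pt.inner_eq, PiLp.sub_apply, PiLp.add_apply] at *
    linear_combination hQB - 2 * h₁
  have hsc : ⟪a + p, c⟫ = ⟪b, c⟫ + ⟪c, a⟫ + ⟪a, b⟫ - ⟪a, a⟫ := by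
    simp only [Pt.inner_eq, PiLp.sub_apply, PiLp.add_apply] at *
    linear_combination hP' - hsb - h₁
  have gram : ⟪a + p, a⟫ * (⟪a, b⟫ * ⟪b, c⟫ - ⟪c, a⟫ * ⟪b, b⟫)
      - ⟪a + p, b⟫ * (⟪a, a⟫ * ⟪b, c⟫ - ⟪a, b⟫ * ⟪c, a⟫)
      + ⟪a + p, c⟫ * (⟪a, a⟫ * ⟪b, b⟫ - ⟪a, b⟫ ^ 2) = 0 := by
    simp only [Pt.inner_eq]
    ring
  rw [hsa, hsb, hsc, ← h₁] at gram
  rw [add_sub_add_right_eq_sub, inner_sub_left, inner_sub_right, inner_sub_right,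
    real_inner_comm a b, ← h₁] at hpos
  refine mul_ne_zero (mul_ne_zero hpos hpos) hsum ?_
  linear_combination -4 * gram

/-- For an acute triangle, the circles on the diameters `AO_a`, `BO_b`, `CO_c`
(where `O_a`, `O_b`, `O_c` are the Apollonius circle centers, i.e. the intersections of the
circumcircle tangents at the vertices with the opposite sidelines) are coaxal with the Euler
line as common radical axis, meet at two points of the Euler line, the power of `H` with
respect to each is half its power with respect to the circumcircle, and the power of `O` with
respect to each is `R²`. -/
theorem stmt_14
    (A B C : Pt) (hABC : AffineIndependent ℝ ![A, B, C])
    (hacute : ∠ B A C < π/2 ∧ ∠ A B C < π/2 ∧ ∠ B C A < π/2)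
    (O H : Pt)
    (hO : dist O A = dist O B ∧ dist O B = dist O C)
    (hH₁ : ⟪H - A, B - C⟫ = 0) (hH₂ : ⟪H - B, C - A⟫ = 0)
    (R : ℝ) (hR : R = dist O A)
    (Oa Ob Oc : Pt)
    (hOa₁ : Oa ∈ line[ℝ, B, C]) (hOa₂ : ⟪Oa - A, A - O⟫ = 0)
    (hOb₁ : Ob ∈ line[ℝ, C, A]) (hOb₂ : ⟪Ob - B, B - O⟫ = 0)
    (hOc₁ : Oc ∈ line[ℝ, A, B]) (hOc₂ : ⟪Oc - C, C - O⟫ = 0)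
    (Pa Pb Pc : Sphere Pt)
    (hPa : Pa = ⟨midpoint ℝ A Oa, dist A Oa / 2⟩)
    (hPb : Pb = ⟨midpoint ℝ B Ob, dist B Ob / 2⟩)
    (hPc : Pc = ⟨midpoint ℝ C Oc, dist C Oc / 2⟩) :
    Coaxal Pa Pb Pc ∧
    radAxis Pa Pb = (line[ℝ, O, H] : Set Pt) ∧
    (∃ L L' : Pt, L ≠ L' ∧ L ∈ Pa ∧ L ∈ Pb ∧ L ∈ Pc ∧ L' ∈ Pa ∧ L' ∈ Pb ∧ L' ∈ Pc ∧
      L ∈ line[ℝ, O, H] ∧ L' ∈ line[ℝ, O, H]) ∧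
    (spow Pa H = spow ⟨O, R⟩ H / 2 ∧ spow Pb H = spow ⟨O, R⟩ H / 2 ∧
      spow Pc H = spow ⟨O, R⟩ H / 2) ∧
    (spow Pa O = R^2 ∧ spow Pb O = R^2 ∧ spow Pc O = R^2) := by
  obtain ⟨hAB, hBC⟩ := hO
  obtain ⟨hA, hB, hC⟩ := hacute
  have hCA : dist O C = dist O A := (hAB.trans hBC).symm
  have hinj := hABC.injective
  have hAB' : A ≠ B := fun e => by simpa using hinj.ne (show (0 : Fin 3) ≠ 1 by decide) e
  have hBC' : B ≠ C := fun e => by simpa using hinj.ne (show (1 : Fin 3) ≠ 2 by decide) e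
  have hCA' : C ≠ A := fun e => by simpa using hinj.ne (show (2 : Fin 3) ≠ 0 by decide) e
  have hneg := circumradius_sq_add_inner_neg hABC hA hB hC hAB hBC
  have hHO := orthocenter_eq hABC hAB hBC hH₁ hH₂
  have iAB := inner_eq_of_dist_eq hAB
  have iBC := inner_eq_of_dist_eq hBC
  have hRB : R = dist O B := hR.trans hAB
  have hRC : R = dist O C := hRB.trans hBC
  have hRpos : 0 < R := by
    refine lt_of_le_of_ne (hR ▸ dist_nonneg) fun h => hAB' ?_
    rw [← dist_eq_zero.1 (hR.symm.trans h.symm), ← dist_eq_zero.1 (hRB.symm.trans h.symm)]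
  have oa : spow Pa O = R ^ 2 := by rw [hPa, hR, spow_circumcenter hOa₂]
  have ob : spow Pb O = R ^ 2 := by rw [hPb, hRB, spow_circumcenter hOb₂]
  have oc : spow Pc O = R ^ 2 := by rw [hPc, hRC, spow_circumcenter hOc₂]
  have ha : spow Pa H = spow ⟨O, R⟩ H / 2 := by
    rw [hPa, hR, spow_orthocenter hAB hBC hHO hOa₁]
  have hb : spow Pb H = spow ⟨O, R⟩ H / 2 := by
    rw [hPb, hRB, spow_orthocenter hBC hCA (by rw [hHO]; abel) hOb₁]
  have hc : spow Pc H = spow ⟨O, R⟩ H / 2 := by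
    rw [hPc, hRC, spow_orthocenter hCA hAB (by rw [hHO]; abel) hOc₁]
  have hOH : O ≠ H := by
    rintro rfl
    rw [oa, spow, dist_self] at ha
    nlinarith
  have hH_neg : spow Pa H < 0 := by
    rw [ha, spow, hR, Pt.dist_sq_eq_inner, Pt.dist_sq_eq_inner, hHO]
    simp only [Pt.inner_eq, PiLp.sub_apply, PiLp.add_apply] at *
    linarith
  have cAB : Pa.center ≠ Pb.center := by
    rw [hPa, hPb]
    exact midpoint_ne_midpoint hAB' hAB hBC hneg.ne hOa₁ hOa₂ hOb₂
  have cBC : Pb.center ≠ Pc.center := by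
    rw [hPb, hPc]
    exact midpoint_ne_midpoint hBC' hBC hCA (by linarith) hOb₁ hOb₂ hOc₂
  have cCA : Pa.center ≠ Pc.center := by
    rw [hPa, hPc]
    exact (midpoint_ne_midpoint hCA' hCA hAB (by linarith) hOc₁ hOc₂ hOa₂).symm
  have rAB := radAxis_eq_line cAB hOH (oa.trans ob.symm) (ha.trans hb.symm)
  have rBC := radAxis_eq_line cBC hOH (ob.trans oc.symm) (hb.trans hc.symm)
  have rAC := radAxis_eq_line cCA hOH (oa.trans oc.symm) (ha.trans hc.symm)
  refine ⟨⟨rAB.trans rBC.symm, rBC.trans rAC.symm⟩, rAB, ?_, ⟨ha, hb, hc⟩, oa, ob, oc⟩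
  have mem_all {l : Pt} (hl : spow Pa l = 0) (hline : l ∈ line[ℝ, O, H]) :
      l ∈ Pa ∧ l ∈ Pb ∧ l ∈ Pc := by
    have lb : spow Pa l = spow Pb l := show l ∈ radAxis Pa Pb from rAB ▸ hline
    have lc : spow Pa l = spow Pc l := show l ∈ radAxis Pa Pc from rAC ▸ hline
    refine ⟨mem_sphere_of_spow_eq_zero ?_ hl, mem_sphere_of_spow_eq_zero ?_ (lb ▸ hl),
      mem_sphere_of_spow_eq_zero ?_ (lc ▸ hl)⟩
    · rw [hPa]; positivity
    · rw [hPb]; positivity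
    · rw [hPc]; positivity
  obtain ⟨l, l', hne, hl, hl', hline, hline'⟩ := exists_two_spow_eq_zero hOH hH_neg
  obtain ⟨la, lb, lc⟩ := mem_all hl hline
  obtain ⟨la', lb', lc'⟩ := mem_all hl' hline'
  exact ⟨l, l', hne, la, lb, lc, la', lb', lc', hline, hline'⟩
end
end
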